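/- Let h, g : ℝ → ℝ be continuous with h(u) > 0 for all u, set γ(τ) = ∫_0^τ h(u)² du, let π̃ be differentiable with π̃'(τ) = −g(τ) and ṽ differentiable with ṽ'(τ) = h(τ)² π̃(τ). Define the absorbed heat kernel H̃(t',y;τ',z) := (2π(τ'−t'))^{-1/2}[exp(−(z−y)²/(2(τ'−t'))) − exp(−(z+y)²/(2(τ'−t')))] for t' < τ'. Fix t' ∈ ℝ and y ∈ ℝ, and define G(τ,b) := exp( π̃(τ)·b + (1/2)∫_0^τ h(u)² π̃(u)² du ) · H̃( t', y; γ(τ), b + ṽ(τ) ). Then G satisfies the forward Schrödinger equation with time-dependent linear potential ∂G/∂τ(τ,b) + g(τ)·b·G(τ,b) = (1/2) h(τ)² ∂²G/∂b²(τ,b) at every (τ,b) with γ(τ) > t'. -/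

import Mathlib

open Real in
/-- The heat kernel on the line: the Gaussian density with mean `a` and variance `s` at `z`. -/
noncomputable def heatKernel (a s z : ℝ) : ℝ :=
  (√(2 * π * s))⁻¹ * exp (-(z - a) ^ 2 / (2 * s))

/-- Derivative of the heat kernel along a differentiable curve in the variance and the space
variable. -/
theorem HasDerivAt.heatKernel {s z : ℝ → ℝ} {s' z' x : ℝ} (a : ℝ)
    (hs : HasDerivAt s s' x) (hz : HasDerivAt z z' x) (hx : 0 < s x) :
    HasDerivAt (fun x => heatKernel a (s x) (z x))
      (heatKernel a (s x) (z x) *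
        (s' * ((z x - a) ^ 2 / (2 * s x ^ 2) - 1 / (2 * s x)) - z' * ((z x - a) / s x))) x := by
  have hpos : 0 < 2 * Real.pi * s x := by positivity
  have hsqrt : 0 < √(2 * Real.pi * s x) := Real.sqrt_pos.2 hpos
  have hnorm := ((hs.const_mul (2 * Real.pi)).sqrt hpos.ne').inv hsqrt.ne'
  have hexp := (((hz.sub_const a).pow 2).neg.div (hs.const_mul 2) (by positivity)).exp
  refine (hnorm.mul hexp).congr_deriv ?_
  simp only [_root_.heatKernel, Pi.neg_apply, Pi.pow_apply, Pi.div_apply, Pi.inv_apply,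
    Real.sq_sqrt hpos.le]
  generalize Real.exp _ = E
  field_simp
  ring

/-- The exponentially tilted and translated heat kernel
`exp (p * b + c) * heatKernel a s (b + v)`. -/
noncomputable def tiltedHeatKernel (a p c s v b : ℝ) : ℝ :=
  Real.exp (p * b + c) * heatKernel a s (b + v)

theorem hasDerivAt_tiltedHeatKernel (a p c v b : ℝ) {s : ℝ} (hs : 0 < s) :
    HasDerivAt (tiltedHeatKernel a p c s v)
      (tiltedHeatKernel a p c s v b * (p - (b + v - a) / s)) b := by
  have hexp := (((hasDerivAt_id b).const_mul p).add_const c).exp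
  have hker := (hasDerivAt_const b s).heatKernel a ((hasDerivAt_id b).add_const v) hs
  refine (hexp.mul hker).congr_deriv ?_
  simp only [tiltedHeatKernel, id]
  ring

theorem hasDerivAt_deriv_tiltedHeatKernel (a p c v b : ℝ) {s : ℝ} (hs : 0 < s) :
    HasDerivAt (deriv (tiltedHeatKernel a p c s v))
      (tiltedHeatKernel a p c s v b * ((p - (b + v - a) / s) ^ 2 - 1 / s)) b := by
  have hderiv : deriv (tiltedHeatKernel a p c s v) =
      fun b => tiltedHeatKernel a p c s v b * (p - (b + v - a) / s) :=
    funext fun b => (hasDerivAt_tiltedHeatKernel a p c v b hs).deriv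
  have hlin := ((((hasDerivAt_id b).add_const v).sub_const a).div_const s).const_sub p
  rw [hderiv]
  refine ((hasDerivAt_tiltedHeatKernel a p c v b hs).mul hlin).congr_deriv ?_
  simp only [id]
  ring

theorem HasDerivAt.tiltedHeatKernel {p c s v : ℝ → ℝ} {p' c' s' v' x : ℝ} (a b : ℝ)
    (hp : HasDerivAt p p' x) (hc : HasDerivAt c c' x) (hs : HasDerivAt s s' x)
    (hv : HasDerivAt v v' x) (hx : 0 < s x) :
    HasDerivAt (fun x => tiltedHeatKernel a (p x) (c x) (s x) (v x) b)
      (tiltedHeatKernel a (p x) (c x) (s x) (v x) b *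
        (p' * b + c' + s' * ((b + v x - a) ^ 2 / (2 * s x ^ 2) - 1 / (2 * s x))
          - v' * ((b + v x - a) / s x))) x := by
  have hexp := ((hp.mul_const b).add hc).exp
  have hker := hs.heatKernel a (hv.const_add b) hx
  refine (hexp.mul hker).congr_deriv ?_
  simp only [_root_.tiltedHeatKernel, Pi.add_apply]
  ring

/-- The second derivative of a difference of two tilted heat kernels. -/
theorem iteratedDeriv_two_tiltedHeatKernel_sub (a a' p c v b : ℝ) {s : ℝ} (hs : 0 < s) :
    iteratedDeriv 2 (fun b => tiltedHeatKernel a p c s v b - tiltedHeatKernel a' p c s v b) b =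
      tiltedHeatKernel a p c s v b * ((p - (b + v - a) / s) ^ 2 - 1 / s) -
        tiltedHeatKernel a' p c s v b * ((p - (b + v - a') / s) ^ 2 - 1 / s) := by
  have hderiv :
      deriv (fun b => tiltedHeatKernel a p c s v b - tiltedHeatKernel a' p c s v b) =
        fun b => deriv (tiltedHeatKernel a p c s v) b - deriv (tiltedHeatKernel a' p c s v) b :=
    funext fun b => deriv_fun_sub (hasDerivAt_tiltedHeatKernel a p c v b hs).differentiableAt
      (hasDerivAt_tiltedHeatKernel a' p c v b hs).differentiableAt
  rw [iteratedDeriv_succ, iteratedDeriv_one, hderiv]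
  exact ((hasDerivAt_deriv_tiltedHeatKernel a p c v b hs).sub
    (hasDerivAt_deriv_tiltedHeatKernel a' p c v b hs)).deriv


/-- With `γ(τ) = ∫_0^τ h(u)² du`, `π̃'(τ) = −g(τ)`, `ṽ'(τ) = h(τ)²π̃(τ)`, and
the absorbed heat kernel
`H̃(t',y;τ',z) = (2π(τ'−t'))^{-1/2}[exp(−(z−y)²/(2(τ'−t'))) − exp(−(z+y)²/(2(τ'−t')))]`,
the Green's function
`G(τ,b) = exp(π̃(τ)b + (1/2)∫_0^τ h(u)²π̃(u)² du)·H̃(t', y; γ(τ), b + ṽ(τ))`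
satisfies the forward Schrödinger equation with time-dependent linear potential
`∂G/∂τ + g(τ)bG = (1/2)h(τ)² ∂²G/∂b²` at every `(τ,b)` with `γ(τ) > t'`. -/
theorem greens_function_forward_schrodinger
    (h g : ℝ → ℝ) (hc : Continuous h) (hgc : Continuous g) (hpos : ∀ u, 0 < h u)
    (γ : ℝ → ℝ) (hγ : ∀ τ, γ τ = ∫ u in (0:ℝ)..τ, (h u) ^ 2)
    (ptil vtil : ℝ → ℝ)
    (hp : ∀ τ, HasDerivAt ptil (-g τ) τ)
    (hv : ∀ τ, HasDerivAt vtil ((h τ) ^ 2 * ptil τ) τ)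
    (Htil : ℝ → ℝ → ℝ → ℝ → ℝ)
    (hHtil : ∀ t' y τ' z, t' < τ' → Htil t' y τ' z =
      (Real.sqrt (2 * Real.pi * (τ' - t')))⁻¹ *
        (Real.exp (-(z - y) ^ 2 / (2 * (τ' - t')))
          - Real.exp (-(z + y) ^ 2 / (2 * (τ' - t')))))
    (t' y : ℝ)
    (G : ℝ → ℝ → ℝ)
    (hG : ∀ τ b, G τ b =
      Real.exp (ptil τ * b + (1 / 2) * ∫ u in (0:ℝ)..τ, (h u) ^ 2 * (ptil u) ^ 2) *
        Htil t' y (γ τ) (b + vtil τ)) :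
    ∀ τ b : ℝ, t' < γ τ →
      deriv (fun τ'' => G τ'' b) τ + g τ * b * G τ b
        = (1 / 2) * (h τ) ^ 2 * iteratedDeriv 2 (fun b' => G τ b') b := by
  intro τ b hτ
  have hpc : Continuous ptil := continuous_iff_continuousAt.2 fun τ => (hp τ).continuousAt
  have hh : Continuous fun u => h u ^ 2 := hc.pow 2
  have hγ' : HasDerivAt γ (h τ ^ 2) τ := by
    rw [funext hγ]
    exact hh.integral_hasStrictDerivAt 0 τ |>.hasDerivAt
  have hI := ((hh.mul (hpc.pow 2)).integral_hasStrictDerivAt 0 τ).hasDerivAt.const_mul (1 / 2)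
  simp only [Pi.mul_apply, Pi.pow_apply] at hI
  have hs : 0 < γ τ - t' := sub_pos.2 hτ
  have hGK : ∀ σ b, t' < γ σ → G σ b =
      tiltedHeatKernel y (ptil σ) (1 / 2 * ∫ u in (0:ℝ)..σ, h u ^ 2 * ptil u ^ 2)
          (γ σ - t') (vtil σ) b -
        tiltedHeatKernel (-y) (ptil σ) (1 / 2 * ∫ u in (0:ℝ)..σ, h u ^ 2 * ptil u ^ 2)
          (γ σ - t') (vtil σ) b := by
    intro σ b hσ
    rw [hG, hHtil _ _ _ _ hσ]
    simp only [tiltedHeatKernel, heatKernel, sub_neg_eq_add]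
    ring
  have hev : ∀ᶠ σ in nhds τ, t' < γ σ := hγ'.continuousAt.eventually (lt_mem_nhds hτ)
  have htime := ((hp τ).tiltedHeatKernel y b hI (hγ'.sub_const t') (hv τ) hs).sub
    ((hp τ).tiltedHeatKernel (-y) b hI (hγ'.sub_const t') (hv τ) hs)
  rw [(htime.congr_of_eventuallyEq (hev.mono fun σ hσ => hGK σ b hσ)).deriv,
    funext fun b => hGK τ b hτ, iteratedDeriv_two_tiltedHeatKernel_sub _ _ _ _ _ _ hs]
  beta_reduce
  field_simp
  ring
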